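/- Let x_L < 0 < x_R, let h⁻, u⁻ solve the linearized Serre equations on [x_L, 0] × [0, ∞) and h⁺, u⁺ solve them on [0, x_R] × [0, ∞), with energies E⁻(t) and E⁺(t) respectively. Then for all t ≥ 0: d/dt(E⁻(t) + E⁺(t)) = BT(h⁺,u⁺)(x_R,t) − BT(h⁻,u⁻)(x_L,t) − Σ_{j=1}^{5} λ_j·( w_j(h⁺,u⁺)(0,t)² − w_j(h⁻,u⁻)(0,t)² ). -/

import Mathlib

open Real MeasureTheory Set

noncomputable section

/-- Partial derivative in the spatial variable `x` (first argument). -/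
def pdX (f : ℝ → ℝ → ℝ) (x t : ℝ) : ℝ := deriv (fun ξ => f ξ t) x

/-- Partial derivative in the temporal variable `t` (second argument). -/
def pdT (f : ℝ → ℝ → ℝ) (x t : ℝ) : ℝ := deriv (fun τ => f x τ) t

/-- `h, u` solve the linearized Serre equations on `[xL, xR] × [0, ∞)`:
they are sufficiently smooth and satisfy the continuity and momentum equations. -/
def SolvesSerre (g H U xL xR : ℝ) (h u : ℝ → ℝ → ℝ) : Prop :=
  ContDiff ℝ 3 (fun p : ℝ × ℝ => h p.1 p.2) ∧
  ContDiff ℝ 3 (fun p : ℝ × ℝ => u p.1 p.2) ∧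
  (∀ x ∈ Set.Icc xL xR, ∀ t : ℝ, 0 ≤ t →
    pdT h x t + pdX (fun ξ τ => H * u ξ τ + U * h ξ τ) x t = 0) ∧
  (∀ x ∈ Set.Icc xL xR, ∀ t : ℝ, 0 ≤ t →
    pdT u x t + pdX (fun ξ τ => g * h ξ τ + U * u ξ τ
      - H ^ 2 * U / 3 * pdX (pdX u) ξ τ
      - H ^ 2 / 3 * pdT (pdX u) ξ τ) x t = 0)

/-- The energy `E(t)` on the interval `[xL, xR]`. -/
def energy (g H xL xR : ℝ) (h u : ℝ → ℝ → ℝ) (t : ℝ) : ℝ :=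
  g / 2 * (∫ x in xL..xR, h x t ^ 2)
    + H / 2 * (∫ x in xL..xR, u x t ^ 2)
    + H ^ 3 / 6 * (∫ x in xL..xR, pdX u x t ^ 2)

/-- The boundary term `BT(h, u)(x, t)`. -/
def BT (g H U : ℝ) (h u : ℝ → ℝ → ℝ) (x t : ℝ) : ℝ :=
  -(g * H) * h x t * u x t - g * U / 2 * h x t ^ 2 - H * U / 2 * u x t ^ 2
    - H ^ 3 * U / 6 * pdX u x t ^ 2
    + H ^ 3 * U / 3 * (u x t * pdX (pdX u) x t)
    + H ^ 3 / 3 * (u x t * pdT (pdX u) x t)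

def sconst (H U : ℝ) : ℝ := Real.sqrt (4 * H ^ 4 + 9 * U ^ 2)
def Cplus (H U : ℝ) : ℝ := Real.sqrt (4 * H ^ 4 + (3 * U + sconst H U) ^ 2)
def Cminus (H U : ℝ) : ℝ := Real.sqrt (4 * H ^ 4 + (3 * U - sconst H U) ^ 2)
def lam1 : ℝ := 0
def lam2 (H U : ℝ) : ℝ := -(H ^ 3 * U) / 6
def lam3 (g U : ℝ) : ℝ := -(g * U) / 2
def lam4 (H U : ℝ) : ℝ := -(H * U) / 4 - H * sconst H U / 12
def lam5 (H U : ℝ) : ℝ := -(H * U) / 4 + H * sconst H U / 12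

def wv1 (u : ℝ → ℝ → ℝ) (x t : ℝ) : ℝ := pdX (pdX u) x t
def wv2 (u : ℝ → ℝ → ℝ) (x t : ℝ) : ℝ := pdX u x t
def wv3 (h : ℝ → ℝ → ℝ) (x t : ℝ) : ℝ := h x t
def wv4 (g H U : ℝ) (h u : ℝ → ℝ → ℝ) (x t : ℝ) : ℝ :=
  1 / Cplus H U * (2 * H ^ 2 * U * pdX (pdX u) x t + 2 * H ^ 2 * pdT (pdX u) x t
    - 6 * g * h x t - (3 * U + sconst H U) * u x t)
def wv5 (g H U : ℝ) (h u : ℝ → ℝ → ℝ) (x t : ℝ) : ℝ :=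
  1 / Cminus H U * (2 * H ^ 2 * U * pdX (pdX u) x t + 2 * H ^ 2 * pdT (pdX u) x t
    - 6 * g * h x t - (3 * U - sconst H U) * u x t)

lemma hasDerivAt_pdX {f : ℝ → ℝ → ℝ} (hf : ContDiff ℝ 1 (fun p : ℝ × ℝ => f p.1 p.2))
    (x t : ℝ) : HasDerivAt (fun ξ => f ξ t) (pdX f x t) x := by
  have hdiff : Differentiable ℝ (fun ξ : ℝ => f ξ t) :=
    (hf.differentiable one_ne_zero).comp (differentiable_id.prodMk (differentiable_const t))
  exact (hdiff x).hasDerivAt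

lemma hasDerivAt_pdT {f : ℝ → ℝ → ℝ} (hf : ContDiff ℝ 1 (fun p : ℝ × ℝ => f p.1 p.2))
    (x t : ℝ) : HasDerivAt (fun τ => f x τ) (pdT f x t) t := by
  have hdiff : Differentiable ℝ (fun τ : ℝ => f x τ) :=
    (hf.differentiable one_ne_zero).comp ((differentiable_const x).prodMk differentiable_id)
  exact (hdiff t).hasDerivAt

lemma contDiff_pdX {f : ℝ → ℝ → ℝ} {m n : WithTop ℕ∞}
    (hf : ContDiff ℝ n (fun p : ℝ × ℝ => f p.1 p.2)) (hmn : m + 1 ≤ n) :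
    ContDiff ℝ m (fun p : ℝ × ℝ => pdX f p.1 p.2) := by
  have hpd : (fun p : ℝ × ℝ => pdX f p.1 p.2)
      = fun p => fderiv ℝ (fun p : ℝ × ℝ => f p.1 p.2) p (1, 0) := by
    funext p
    have hf1 : ContDiff ℝ 1 (fun p : ℝ × ℝ => f p.1 p.2) := hf.of_le (le_add_self.trans hmn)
    have hcurve : HasDerivAt (fun ξ : ℝ => (ξ, p.2)) ((1 : ℝ), (0 : ℝ)) p.1 :=
      (hasDerivAt_id p.1).prodMk (hasDerivAt_const p.1 p.2)
    exact (((hf1.differentiable one_ne_zero) p).hasFDerivAt.comp_hasDerivAt p.1 hcurve).deriv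
  rw [hpd]
  exact (hf.fderiv_right hmn).clm_apply contDiff_const

lemma contDiff_pdT {f : ℝ → ℝ → ℝ} {m n : WithTop ℕ∞}
    (hf : ContDiff ℝ n (fun p : ℝ × ℝ => f p.1 p.2)) (hmn : m + 1 ≤ n) :
    ContDiff ℝ m (fun p : ℝ × ℝ => pdT f p.1 p.2) := by
  have hpd : (fun p : ℝ × ℝ => pdT f p.1 p.2)
      = fun p => fderiv ℝ (fun p : ℝ × ℝ => f p.1 p.2) p (0, 1) := by
    funext p
    have hf1 : ContDiff ℝ 1 (fun p : ℝ × ℝ => f p.1 p.2) := hf.of_le (le_add_self.trans hmn)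
    have hcurve : HasDerivAt (fun τ : ℝ => (p.1, τ)) ((0 : ℝ), (1 : ℝ)) p.2 :=
      (hasDerivAt_const p.2 p.1).prodMk (hasDerivAt_id p.2)
    exact (((hf1.differentiable one_ne_zero) p).hasFDerivAt.comp_hasDerivAt p.2 hcurve).deriv
  rw [hpd]
  exact (hf.fderiv_right hmn).clm_apply contDiff_const

lemma continuous_slice {f : ℝ → ℝ → ℝ} (hf : Continuous (fun p : ℝ × ℝ => f p.1 p.2)) (t : ℝ) :
    Continuous (fun x => f x t) :=
  hf.comp (continuous_id.prodMk continuous_const)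

/-- Differentiation under the integral sign for a `C¹` integrand. -/
lemma hasDerivAt_integral_pdT {f : ℝ → ℝ → ℝ}
    (hf : ContDiff ℝ 1 (fun p : ℝ × ℝ => f p.1 p.2)) (a b t : ℝ) :
    HasDerivAt (fun τ => ∫ x in a..b, f x τ) (∫ x in a..b, pdT f x t) t := by
  have hcont : Continuous (fun p : ℝ × ℝ => pdT f p.1 p.2) :=
    (contDiff_pdT (m := 0) hf (by norm_num)).continuous
  obtain ⟨C, hC⟩ := (isCompact_uIcc.prod (isCompact_closedBall t 1)).exists_bound_of_continuousOn
    (s := Set.uIcc a b ×ˢ Metric.closedBall t 1) hcont.continuousOn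
  refine (intervalIntegral.hasDerivAt_integral_of_dominated_loc_of_deriv_le
    (F := fun τ x => f x τ) (F' := fun τ x => pdT f x τ) (bound := fun _ => C)
    (Metric.closedBall_mem_nhds t one_pos) ?_ ?_ ?_ ?_ ?_ ?_).2
  · exact .of_forall fun τ => (continuous_slice hf.continuous τ).aestronglyMeasurable
  · exact (continuous_slice hf.continuous t).intervalIntegrable a b
  · exact (continuous_slice hcont t).aestronglyMeasurable
  · exact .of_forall fun x hx τ hτ => hC (x, τ) ⟨Set.uIoc_subset_uIcc hx, hτ⟩
  · exact intervalIntegrable_const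
  · exact .of_forall fun x _ τ _ => hasDerivAt_pdT hf x τ

lemma hasDerivAt_integral_sq {f : ℝ → ℝ → ℝ}
    (hf : ContDiff ℝ 1 (fun p : ℝ × ℝ => f p.1 p.2)) (a b t : ℝ) :
    HasDerivAt (fun τ => ∫ x in a..b, f x τ ^ 2) (∫ x in a..b, 2 * (f x t * pdT f x t)) t := by
  have hsq : (fun x => 2 * (f x t * pdT f x t)) = fun x => pdT (fun x τ => f x τ ^ 2) x t := by
    funext x
    refine (((hasDerivAt_pdT hf x t).pow 2).deriv.trans ?_).symm
    norm_num
    ring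
  rw [hsq]
  exact hasDerivAt_integral_pdT (hf.pow 2) a b t

/-- The energy density satisfies a conservation law with flux `-BT`. -/
lemma hasDerivAt_BT {g H U a b : ℝ} {h u : ℝ → ℝ → ℝ} (hsol : SolvesSerre g H U a b h u)
    {x t : ℝ} (hx : x ∈ Set.Icc a b) (ht : 0 ≤ t) :
    HasDerivAt (fun ξ => BT g H U h u ξ t)
      (g / 2 * (2 * (h x t * pdT h x t)) + H / 2 * (2 * (u x t * pdT u x t))
        + H ^ 3 / 6 * (2 * (pdX u x t * pdT (pdX u) x t))) x := by
  obtain ⟨hh, hu, hmass, hmom⟩ := hsol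
  have dh := hasDerivAt_pdX (hh.of_le (by norm_num)) x t
  have du := hasDerivAt_pdX (hu.of_le (by norm_num)) x t
  have cux : ContDiff ℝ 2 (fun p : ℝ × ℝ => pdX u p.1 p.2) := contDiff_pdX hu (by norm_num)
  have dux := hasDerivAt_pdX (cux.of_le (by norm_num)) x t
  have duxx := hasDerivAt_pdX (contDiff_pdX cux (by norm_num)) x t
  have duxt := hasDerivAt_pdX (contDiff_pdT cux (by norm_num)) x t
  have emass := hmass x hx t ht
  have emom := hmom x hx t ht
  have fmass := ((du.const_mul H).add (dh.const_mul U)).deriv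
  have fmom := ((((dh.const_mul g).add (du.const_mul U)).sub
    (duxx.const_mul (H ^ 2 * U / 3))).sub (duxt.const_mul (H ^ 2 / 3))).deriv
  rw [pdX] at emass emom
  have emass' : pdT h x t + (H * pdX u x t + U * pdX h x t) = 0 := by
    rw [← fmass]; exact emass
  have emom' : pdT u x t + (g * pdX h x t + U * pdX u x t
      - H ^ 2 * U / 3 * pdX (pdX (pdX u)) x t - H ^ 2 / 3 * pdX (pdT (pdX u)) x t) = 0 := by
    rw [← fmom]; exact emom
  have dBT := ((((((dh.const_mul (-(g * H))).mul du).sub ((dh.pow 2).const_mul (g * U / 2))).sub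
    ((du.pow 2).const_mul (H * U / 2))).sub ((dux.pow 2).const_mul (H ^ 3 * U / 6))).add
    ((du.mul duxx).const_mul (H ^ 3 * U / 3))).add ((du.mul duxt).const_mul (H ^ 3 / 3))
  refine HasDerivAt.congr_deriv dBT ?_
  norm_num
  linear_combination -(g * h x t) * emass' - H * u x t * emom'

lemma hasDerivAt_energy {g H U a b : ℝ} {h u : ℝ → ℝ → ℝ} (hab : a ≤ b)
    (hsol : SolvesSerre g H U a b h u) {t : ℝ} (ht : 0 ≤ t) :
    HasDerivAt (energy g H a b h u) (BT g H U h u b t - BT g H U h u a t) t := by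
  have ch : ContDiff ℝ 1 (fun p : ℝ × ℝ => h p.1 p.2) := hsol.1.of_le (by norm_num)
  have cu : ContDiff ℝ 1 (fun p : ℝ × ℝ => u p.1 p.2) := hsol.2.1.of_le (by norm_num)
  have cux : ContDiff ℝ 1 (fun p : ℝ × ℝ => pdX u p.1 p.2) :=
    contDiff_pdX (hsol.2.1.of_le (m := 2) (by norm_num)) (by norm_num)
  have cint {f : ℝ → ℝ → ℝ} (hf : ContDiff ℝ 1 (fun p : ℝ × ℝ => f p.1 p.2)) (c : ℝ) :
      IntervalIntegrable (fun x => c * (2 * (f x t * pdT f x t))) volume a b :=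
    (((continuous_slice hf.continuous t).mul (continuous_slice
      (contDiff_pdT (m := 0) hf (by norm_num)).continuous t)).const_mul 2
      |>.const_mul c).intervalIntegrable a b
  refine ((((hasDerivAt_integral_sq ch a b t).const_mul (g / 2)).add
    ((hasDerivAt_integral_sq cu a b t).const_mul (H / 2))).add
    ((hasDerivAt_integral_sq cux a b t).const_mul (H ^ 3 / 6))).congr_deriv ?_
  rw [← intervalIntegral.integral_eq_sub_of_hasDerivAt
    (fun x hx => hasDerivAt_BT hsol (Set.uIcc_of_le hab ▸ hx) ht)
    (((cint ch _).add (cint cu _)).add (cint cux _)),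
    intervalIntegral.integral_add ((cint ch _).add (cint cu _)) (cint cux _),
    intervalIntegral.integral_add (cint ch _) (cint cu _)]
  simp only [intervalIntegral.integral_const_mul]

lemma sconst_sq (H U : ℝ) : sconst H U ^ 2 = 4 * H ^ 4 + 9 * U ^ 2 :=
  Real.sq_sqrt (by positivity)

lemma abs_lt_sconst {H : ℝ} (hH : 0 < H) (U : ℝ) : |3 * U| < sconst H U := by
  apply Real.lt_sqrt_of_sq_lt
  rw [sq_abs]
  nlinarith [pow_pos hH 4]

/-- The boundary term is diagonalized by the characteristic variables. -/
lemma BT_eq_sum_lam_mul_wv_sq {H : ℝ} (hH : 0 < H) (g U : ℝ) (h u : ℝ → ℝ → ℝ) (x t : ℝ) :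
    BT g H U h u x t = lam1 * wv1 u x t ^ 2 + lam2 H U * wv2 u x t ^ 2 + lam3 g U * wv3 h x t ^ 2
      + lam4 H U * wv4 g H U h u x t ^ 2 + lam5 H U * wv5 g H U h u x t ^ 2 := by
  obtain ⟨hlo, hhi⟩ := abs_lt.mp (abs_lt_sconst hH U)
  have hs : 0 < sconst H U := (abs_nonneg _).trans_lt (abs_lt_sconst hH U)
  have hp : sconst H U + 3 * U ≠ 0 := by linarith
  have hm : sconst H U - 3 * U ≠ 0 := by linarith
  have hCp : Cplus H U ^ 2 = 2 * sconst H U * (sconst H U + 3 * U) := by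
    rw [Cplus, Real.sq_sqrt (by positivity)]
    linear_combination -sconst_sq H U
  have hCm : Cminus H U ^ 2 = 2 * sconst H U * (sconst H U - 3 * U) := by
    rw [Cminus, Real.sq_sqrt (by positivity)]
    linear_combination -sconst_sq H U
  have hlp : lam4 H U * (1 / Cplus H U) ^ 2 = -(H / (24 * sconst H U)) := by
    rw [lam4, one_div_pow, hCp, ← neg_div, mul_one_div,
      div_eq_div_iff (mul_ne_zero (by positivity) hp) (by positivity)]
    ring
  have hlm : lam5 H U * (1 / Cminus H U) ^ 2 = H / (24 * sconst H U) := by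
    rw [lam5, one_div_pow, hCm, mul_one_div,
      div_eq_div_iff (mul_ne_zero (by positivity) hm) (by positivity)]
    ring
  rw [wv4, wv5, mul_pow, mul_pow, ← mul_assoc, ← mul_assoc, hlp, hlm]
  simp only [BT, lam1, lam2, lam3, wv1, wv2, wv3]
  field_simp
  ring

/-- Lemma 3.9: the rate of change of the total energy of the coupled problem equals
the outer boundary terms plus the interface term. -/
theorem energy_rate_interface (g H U xL xR : ℝ) (hg : 0 < g) (hH : 0 < H)
    (hxL : xL < 0) (hxR : 0 < xR) (hm um hp up : ℝ → ℝ → ℝ)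
    (hsolm : SolvesSerre g H U xL 0 hm um) (hsolp : SolvesSerre g H U 0 xR hp up) :
    ∀ t : ℝ, 0 ≤ t →
      HasDerivWithinAt
        (fun τ => energy g H xL 0 hm um τ + energy g H 0 xR hp up τ)
        (BT g H U hp up xR t - BT g H U hm um xL t
          - (lam1 * (wv1 up 0 t ^ 2 - wv1 um 0 t ^ 2)
            + lam2 H U * (wv2 up 0 t ^ 2 - wv2 um 0 t ^ 2)
            + lam3 g U * (wv3 hp 0 t ^ 2 - wv3 hm 0 t ^ 2)
            + lam4 H U * (wv4 g H U hp up 0 t ^ 2 - wv4 g H U hm um 0 t ^ 2)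
            + lam5 H U * (wv5 g H U hp up 0 t ^ 2 - wv5 g H U hm um 0 t ^ 2)))
        (Set.Ici 0) t := by
  intro t ht
  refine (((hasDerivAt_energy hxL.le hsolm ht).add
    (hasDerivAt_energy hxR.le hsolp ht)).congr_deriv ?_).hasDerivWithinAt
  rw [BT_eq_sum_lam_mul_wv_sq hH g U hm um 0 t, BT_eq_sum_lam_mul_wv_sq hH g U hp up 0 t]
  ring
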